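/- arXiv:1912.05835 — 3 statements merged into one kernel-verified Lean document; each statement's English description precedes it below -/
import Mathlib

section
/- Let y : ℝ³ × (0,T) → ℝ³ be twice continuously differentiable (jointly in (x,t)). Then the cofactor matrix of the spatial gradient satisfies the transport identity ∂_t (cof ∇_x y)_{kγ}(x,t) = Σ_α ∂_α( Σ_{i,j,β} ε_{ijk} ε_{αβγ} (∂_β y_j(x,t)) (∂_t y_i(x,t)) ) for all indices k, γ ∈ {1,2,3} and all (x,t). -/
open scoped BigOperators
noncomputable section

/-- 3×3 real matrices, modelled as `Fin 3 → Fin 3 → ℝ`. -/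
abbrev Mat : Type := Fin 3 → Fin 3 → ℝ

/-- The Levi-Civita symbol on `{0,1,2}`. -/
def lc (i j k : Fin 3) : ℝ :=
  (((j : ℕ) : ℝ) - ((i : ℕ) : ℝ)) * (((k : ℕ) : ℝ) - ((i : ℕ) : ℝ)) *
    (((k : ℕ) : ℝ) - ((j : ℕ) : ℝ)) / 2

/-- The cofactor matrix `(cof F)_{iα} = (1/2) Σ ε_{ijk} ε_{αβγ} F_{jβ} F_{kγ}`. -/
def cof (F : Mat) : Mat := fun i α =>
  (1 / 2) * ∑ j, ∑ k, ∑ β, ∑ γ, lc i j k * lc α β γ * F j β * F k γ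

/-- The determinant `det F = (1/6) Σ ε_{ijk} ε_{αβγ} F_{iα} F_{jβ} F_{kγ}`. -/
def mdet (F : Mat) : ℝ :=
  (1 / 6) * ∑ i, ∑ j, ∑ k, ∑ α, ∑ β, ∑ γ, lc i j k * lc α β γ * F i α * F j β * F k γ

/-- Frobenius norm of a 3×3 matrix. -/
def frob (F : Mat) : ℝ := Real.sqrt (∑ i, ∑ j, F i j ^ 2)

/-- Space-time points `(x,t) ∈ ℝ³ × ℝ`. -/
abbrev Pt : Type := (Fin 3 → ℝ) × ℝ

/-- The open time slab `ℝ³ × (0,T)`. -/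
def oslab (T : ℝ) : Set Pt := {p | 0 < p.2 ∧ p.2 < T}

/-- Spatial partial derivative `∂_α f` of a scalar function on space-time. -/
def pdx (α : Fin 3) (f : Pt → ℝ) (p : Pt) : ℝ :=
  fderiv ℝ f p (Pi.single α 1, 0)

/-- Time derivative `∂_t f` of a scalar function on space-time. -/
def pdt (f : Pt → ℝ) (p : Pt) : ℝ :=
  fderiv ℝ f p (0, 1)

/-- The spatial gradient matrix `(∇ₓ y)_{iα} = ∂_α y_i`. -/
def gradx (y : Pt → Fin 3 → ℝ) (p : Pt) : Mat :=
  fun i α => pdx α (fun q => y q i) p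

theorem isOpen_oslab (T : ℝ) : IsOpen (oslab T) :=
  (isOpen_lt continuous_const continuous_snd).inter (isOpen_lt continuous_snd continuous_const)

theorem ContDiffAt.hasFDerivAt_fderiv_apply {f : Pt → ℝ} {p : Pt} (hf : ContDiffAt ℝ 2 f p)
    (v : Pt) :
    HasFDerivAt (fun q => fderiv ℝ f q v) ((fderiv ℝ (fderiv ℝ f) p).flip v) p := by
  have h : HasFDerivAt (fderiv ℝ f) (fderiv ℝ (fderiv ℝ f) p) p :=
    ((hf.fderiv_right (m := 1) (by norm_num)).differentiableAt (by norm_num)).hasFDerivAt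
  simpa using h.clm_apply (hasFDerivAt_const v p)

/-- The derivative of a cofactor entry of a differentiable matrix field. -/
theorem hasFDerivAt_cof {F : Pt → Mat} {F' : Fin 3 → Fin 3 → Pt →L[ℝ] ℝ} {p : Pt}
    (hF : ∀ i α, HasFDerivAt (fun q => F q i α) (F' i α) p) (k γ : Fin 3) :
    HasFDerivAt (fun q => cof (F q) k γ)
      ((1 / 2 : ℝ) • ∑ i, ∑ j, ∑ α, ∑ β,
        ((lc k i j * lc γ α β * F p i α) • F' j β +
          F p j β • (lc k i j * lc γ α β) • F' i α)) p := by
  unfold cof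
  refine HasFDerivAt.const_mul ?_ _
  exact HasFDerivAt.fun_sum fun i _ => HasFDerivAt.fun_sum fun j _ =>
    HasFDerivAt.fun_sum fun α _ => HasFDerivAt.fun_sum fun β _ =>
      ((hF i α).const_mul _).mul (hF j β)

/-- The algebraic core of the transport identity: `F` is the gradient, `G` its time derivative,
`M` the spatial Hessian and `v` the velocity. -/
theorem cof_transport_algebra (F G : Mat) (M : Fin 3 → Fin 3 → Fin 3 → ℝ) (v : Fin 3 → ℝ)
    (hM : ∀ i α β, M i α β = M i β α) (k γ : Fin 3) :
    (1 / 2 : ℝ) * ∑ i, ∑ j, ∑ α, ∑ β,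
        (lc k i j * lc γ α β * F i α * G j β + F j β * (lc k i j * lc γ α β * G i α)) =
      ∑ α, ∑ i, ∑ j, ∑ β,
        (lc i j k * lc α β γ * F j β * G i α + v i * (lc i j k * lc α β γ * M j α β)) := by
  have h₁ := fun i => hM i 1 0
  have h₂ := fun i => hM i 2 0
  have h₃ := fun i => hM i 2 1
  fin_cases k <;> fin_cases γ <;>
    simp [Fin.sum_univ_three, lc, h₁, h₂, h₃] <;> ring

/-- transport identity for the cofactor matrix.  If
`y : ℝ³ × (0,T) → ℝ³` is twice continuously differentiable, then
`∂_t (cof ∇ₓ y)_{kγ} = Σ_α ∂_α( Σ_{i,j,β} ε_{ijk} ε_{αβγ} (∂_β y_j)(∂_t y_i) )`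
on `ℝ³ × (0,T)`, for all `k, γ`. -/
theorem cof_transport_identity (T : ℝ)
    (y : Pt → Fin 3 → ℝ) (hy : ContDiffOn ℝ 2 y (oslab T)) :
    ∀ k γ : Fin 3, ∀ p ∈ oslab T,
      pdt (fun q => cof (gradx y q) k γ) p
        = ∑ α, pdx α
            (fun q => ∑ i, ∑ j, ∑ β,
              lc i j k * lc α β γ * pdx β (fun q' => y q' j) q * pdt (fun q' => y q' i) q) p := by
  intro k γ p hp
  have hy' (i : Fin 3) : ContDiffAt ℝ 2 (fun q => y q i) p :=
    contDiffAt_pi.1 (hy.contDiffAt ((isOpen_oslab T).mem_nhds hp)) i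
  have hD (i : Fin 3) (v : Pt) := (hy' i).hasFDerivAt_fderiv_apply v
  have hsymm (i : Fin 3) : IsSymmSndFDerivAt ℝ (fun q => y q i) p :=
    (hy' i).isSymmSndFDerivAt (by simp)
  have hcof := hasFDerivAt_cof (F := gradx y) (fun i α => hD i (Pi.single α 1, 0)) k γ
  have hflux (α : Fin 3) := HasFDerivAt.fun_sum (u := Finset.univ) fun i _ =>
    HasFDerivAt.fun_sum (u := Finset.univ) fun j _ =>
      HasFDerivAt.fun_sum (u := Finset.univ) fun β _ =>
        ((hD j (Pi.single β 1, 0)).const_mul (lc i j k * lc α β γ)).mul (hD i (0, 1))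
  have key := cof_transport_algebra (gradx y p)
    (fun i α => fderiv ℝ (fderiv ℝ fun q => y q i) p (0, 1) (Pi.single α 1, 0))
    (fun i α β => fderiv ℝ (fderiv ℝ fun q => y q i) p (Pi.single α 1, 0) (Pi.single β 1, 0))
    (fun i => pdt (fun q => y q i) p) (fun i α β => (hsymm i).eq _ _) k γ
  have hL : pdt (fun q => cof (gradx y q) k γ) p = _ := congrArg (· (0, 1)) hcof.fderiv
  have hR (α : Fin 3) : pdx α (fun q => ∑ i, ∑ j, ∑ β,
      lc i j k * lc α β γ * pdx β (fun q' => y q' j) q * pdt (fun q' => y q' i) q) p = _ :=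
    congrArg (· (Pi.single α 1, 0)) (hflux α).fderiv
  rw [hL, Finset.sum_congr rfl fun α _ => hR α]
  simp only [sum_apply, add_apply,
    smul_apply, ContinuousLinearMap.flip_apply, smul_eq_mul]
  refine key.trans ?_
  refine Finset.sum_congr rfl fun α _ => Finset.sum_congr rfl fun i _ =>
    Finset.sum_congr rfl fun j _ => Finset.sum_congr rfl fun β _ => ?_
  rw [(hsymm i).eq (0, 1)]
  rfl
end
end

section
/- (Propagation of the constraint ξ = Φ(F) for smooth solutions of the augmented system.) Let v : ℝ³×[0,T] → ℝ³ be C², let y⁰ : ℝ³ → ℝ³ be C², and let ξ = (F,ζ,w) : ℝ³×[0,T] → M₃(ℝ)×M₃(ℝ)×ℝ be C¹ with F also C¹ in x, satisfying pointwise: ∂_t F_{iβ} = ∂_β v_i, ∂_t ζ_{kγ} = Σ_α ∂_α( Σ_{i,j,β} ε_{ijk}ε_{αβγ} F_{jβ} v_i ), ∂_t w = Σ_{i,α} ∂_α( (cof F)_{iα} v_i ), together with the initial conditions F(·,0) = ∇y⁰, ζ(·,0) = cof F(·,0), w(·,0) = det F(·,0). Then for every t ∈ [0,T]: F(·,t)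 = ∇_x y(·,t) where y(x,t) = y⁰(x) + ∫₀ᵗ v(x,s) ds, and ζ(·,t) = cof F(·,t), w(·,t) = det F(·,t). -/
open scoped BigOperators
noncomputable section

/-- The closed time slab `ℝ³ × [0,T]`. -/
def slab (T : ℝ) : Set Pt := {p | p.2 ∈ Set.Icc 0 T}

/-- Spatial partial derivative `∂_α f` within the slab `S`. -/
def pdxW (S : Set Pt) (α : Fin 3) (f : Pt → ℝ) (p : Pt) : ℝ :=
  fderivWithin ℝ f S p (Pi.single α 1, 0)

/-- Time derivative `∂_t f` within the slab `S`. -/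
def pdtW (S : Set Pt) (f : Pt → ℝ) (p : Pt) : ℝ :=
  fderivWithin ℝ f S p (0, 1)

theorem cof_apply (F : Mat) (i α : Fin 3) :
    cof F i α = F (i + 1) (α + 1) * F (i + 2) (α + 2) - F (i + 1) (α + 2) * F (i + 2) (α + 1) := by
  fin_cases i <;> fin_cases α <;> simp [cof, lc, Fin.sum_univ_three] <;> ring

theorem mdet_eq_sum_cof (F : Mat) : mdet F = ∑ α, F 0 α * cof F 0 α := by
  simp only [cof_apply]
  simp [mdet, lc, Fin.sum_univ_three]
  ring

/-- For a field `f` whose first derivatives `d` are curl free, the divergence of the flux of the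
cofactor equation only involves the derivatives `a` of the velocity `u`. -/
theorem sum_piola_flux (f : Mat) (d : Fin 3 → Fin 3 → Fin 3 → ℝ) (u : Fin 3 → ℝ)
    (a : Fin 3 → Fin 3 → ℝ)
    (hd : ∀ i α β, d α i β = d β i α) (k γ : Fin 3) :
    ∑ α, ∑ i, ∑ j, ∑ β, (lc i j k * lc α β γ * f j β * a α i
      + u i * (lc i j k * lc α β γ * d α j β)) =
    f (k + 1) (γ + 1) * a (γ + 2) (k + 2) + f (k + 2) (γ + 2) * a (γ + 1) (k + 1)
     - (f (k + 1) (γ + 2) * a (γ + 1) (k + 2) + f (k + 2) (γ + 1) * a (γ + 2) (k + 1)) := by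
  have h10 := fun i => hd i 1 0
  have h20 := fun i => hd i 2 0
  have h21 := fun i => hd i 2 1
  fin_cases k <;> fin_cases γ <;> simp [lc, Fin.sum_univ_three, h10, h20, h21] <;> ring

theorem uniqueDiffOn_slab {T : ℝ} (hT : 0 < T) : UniqueDiffOn ℝ (slab T) := by
  have : slab T = Set.univ ×ˢ Set.Icc 0 T := by
    ext p
    simp [slab]
  rw [this]
  exact uniqueDiffOn_univ.prod (uniqueDiffOn_Icc hT)

theorem HasFDerivWithinAt.slab_time {T : ℝ} {f : Pt → ℝ} {f' : Pt →L[ℝ] ℝ} {x : Fin 3 → ℝ} {t : ℝ}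
    (hf : HasFDerivWithinAt f f' (slab T) (x, t)) :
    HasDerivWithinAt (fun s => f (x, s)) (f' (0, 1)) (Set.Icc 0 T) t :=
  hf.comp_hasDerivWithinAt (f := fun s => (x, s)) t
    ((hasDerivWithinAt_const t _ x).prodMk (hasDerivWithinAt_id t _)) fun _ hs => hs

theorem HasFDerivWithinAt.slab_space {T : ℝ} {f : Pt → ℝ} {f' : Pt →L[ℝ] ℝ} {x : Fin 3 → ℝ}
    {t : ℝ} (hf : HasFDerivWithinAt f f' (slab T) (x, t)) (ht : t ∈ Set.Icc 0 T) :
    HasFDerivAt (fun z => f (z, t)) (f'.comp (.inl ℝ _ ℝ)) x := by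
  rw [← hasFDerivWithinAt_univ]
  exact hf.comp (f := fun z => (z, t)) x (hasFDerivAt_prodMk_left x t).hasFDerivWithinAt
    fun _ _ => ht

/-- A function on the slab with vanishing time derivative is determined by its initial values. -/
theorem eq_initial_of_pdtW_eq_zero {T : ℝ} (hT : 0 < T) {f : Pt → ℝ}
    (hf : DifferentiableOn ℝ f (slab T)) (h0 : ∀ p ∈ slab T, pdtW (slab T) f p = 0)
    {p : Pt} (hp : p ∈ slab T) : f p = f (p.1, 0) := by
  have hd : ∀ t ∈ Set.Icc 0 T, HasDerivWithinAt (fun s => f (p.1, s)) 0 (Set.Icc 0 T) t := by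
    intro t ht
    have := (hf (p.1, t) ht).hasFDerivWithinAt.slab_time
    rwa [show fderivWithin ℝ f (slab T) (p.1, t) (0, 1) = 0 from h0 (p.1, t) ht] at this
  exact constant_of_derivWithin_zero (f := fun s => f (p.1, s))
    (fun t ht => (hd t ht).differentiableWithinAt)
    (fun t ht => (hd t (Set.Ico_subset_Icc_self ht)).derivWithin
      (uniqueDiffOn_Icc hT t (Set.Ico_subset_Icc_self ht))) p.2 hp

theorem continuousOn_slab_time {E : Type*} [TopologicalSpace E] {T : ℝ} {g : Pt → E}
    (hg : ContinuousOn g (slab T)) (x : Fin 3 → ℝ) {t : ℝ} (ht : t ∈ Set.Icc 0 T) :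
    ContinuousOn (fun s => g (x, s)) (Set.uIcc 0 t) :=
  hg.comp (by fun_prop) fun s hs => by
    rw [Set.uIcc_of_le ht.1] at hs
    exact ⟨hs.1, hs.2.trans ht.2⟩

/-- Differentiation in space of the time integral of a `C¹` function on the slab. -/
theorem hasFDerivAt_integral_slab {T : ℝ} (hT : 0 < T) {u : Pt → ℝ}
    (hu : ContDiffOn ℝ 1 u (slab T)) (x : Fin 3 → ℝ) {t : ℝ} (ht : t ∈ Set.Icc 0 T) :
    HasFDerivAt (fun z => ∫ s in (0 : ℝ)..t, u (z, s))
      (∫ s in (0 : ℝ)..t, (fderivWithin ℝ u (slab T) (x, s)).comp (.inl ℝ _ ℝ)) x := by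
  let G : Pt → (Fin 3 → ℝ) →L[ℝ] ℝ :=
    fun p => (fderivWithin ℝ u (slab T) p).comp (.inl ℝ _ ℝ)
  have hGc : ContinuousOn G (slab T) :=
    (hu.continuousOn_fderivWithin (uniqueDiffOn_slab hT) le_rfl).clm_comp continuousOn_const
  have hmem : ∀ s ∈ Set.uIoc 0 t, s ∈ Set.Icc 0 T := by
    intro s hs
    rw [Set.uIoc_of_le ht.1] at hs
    exact ⟨hs.1.le, hs.2.trans ht.2⟩
  have hcpt : IsCompact (Metric.closedBall x 1 ×ˢ Set.Icc 0 T) :=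
    (isCompact_closedBall x 1).prod isCompact_Icc
  obtain ⟨C, hC⟩ := hcpt.exists_bound_of_continuousOn (hGc.mono fun p hp => hp.2)
  refine intervalIntegral.hasFDerivAt_integral_of_dominated_of_fderiv_le
    (F := fun z s => u (z, s)) (F' := fun z s => G (z, s)) (bound := fun _ => C)
    (Metric.closedBall_mem_nhds x one_pos) (.of_forall fun z => ?_) ?_ ?_ ?_ ?_ ?_
  · exact (continuousOn_slab_time hu.continuousOn z ht).intervalIntegrable.def'.aestronglyMeasurable
  · exact (continuousOn_slab_time hu.continuousOn x ht).intervalIntegrable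
  · exact (continuousOn_slab_time hGc x ht).intervalIntegrable.def'.aestronglyMeasurable
  · exact .of_forall fun s hs z hz => hC (z, s) ⟨hz, hmem s hs⟩
  · exact intervalIntegrable_const
  · exact .of_forall fun s hs z _ =>
      (hu.differentiableOn one_ne_zero (z, s) (hmem s hs)).hasFDerivWithinAt.slab_space (hmem s hs)

theorem clm_eq_sum_proj (L : (Fin 3 → ℝ) →L[ℝ] ℝ) :
    L = ∑ α, L (Pi.single α 1) •
      ContinuousLinearMap.proj (R := ℝ) (φ := fun _ : Fin 3 => ℝ) α := by
  ext z
  conv_lhs => rw [pi_eq_sum_univ' z, map_sum]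
  simp [mul_comm]

/-- If the time derivative of each `f α` is the spatial derivative `∂_α u`, then the `f α` remain
the components of the gradient of `g + ∫ u` when they initially are the gradient of `g`. -/
theorem hasFDerivAt_add_integral_slab {T : ℝ} (hT : 0 < T) {u : Pt → ℝ}
    (hu : ContDiffOn ℝ 1 u (slab T)) {g : (Fin 3 → ℝ) → ℝ} (hg : Differentiable ℝ g)
    {f : Fin 3 → Pt → ℝ} (hf : ∀ α, ContDiffOn ℝ 1 (f α) (slab T))
    (heq : ∀ p ∈ slab T, ∀ α, pdtW (slab T) (f α) p = pdxW (slab T) α u p)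
    (h0 : ∀ x α, f α (x, 0) = fderiv ℝ g x (Pi.single α 1))
    (x : Fin 3 → ℝ) {t : ℝ} (ht : t ∈ Set.Icc 0 T) :
    HasFDerivAt (fun z => g z + ∫ s in (0 : ℝ)..t, u (z, s))
      (∑ α, f α (x, t) • ContinuousLinearMap.proj (R := ℝ) (φ := fun _ : Fin 3 => ℝ) α) x := by
  have hsub : Set.Icc 0 t ⊆ Set.Icc 0 T := Set.Icc_subset_Icc_right ht.2
  have hGc : ContinuousOn (fun p => (fderivWithin ℝ u (slab T) p).comp
      (.inl ℝ (Fin 3 → ℝ) ℝ)) (slab T) :=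
    (hu.continuousOn_fderivWithin (uniqueDiffOn_slab hT) le_rfl).clm_comp continuousOn_const
  have hGt := continuousOn_slab_time hGc x ht
  refine ((hg x).hasFDerivAt.fun_add (hasFDerivAt_integral_slab hT hu x ht)).congr_fderiv ?_
  rw [clm_eq_sum_proj (_ + _)]
  refine Finset.sum_congr rfl fun α _ => ?_
  have hftc : ∫ s in (0 : ℝ)..t, pdxW (slab T) α u (x, s) = f α (x, t) - f α (x, 0) := by
    refine intervalIntegral.integral_eq_sub_of_hasDerivAt_of_le
      (f := fun s => f α (x, s)) ht.1 ?_ (fun s hs => ?_) ?_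
    · simpa [Set.uIcc_of_le ht.1] using continuousOn_slab_time (hf α).continuousOn x ht
    · have hs' : s ∈ Set.Icc 0 T := hsub (Set.Ioo_subset_Icc_self hs)
      have := ((hf α).differentiableOn one_ne_zero (x, s) hs').hasFDerivWithinAt.slab_time
      rw [← heq (x, s) hs' α]
      exact this.hasDerivAt (Icc_mem_nhds hs.1 (hs.2.trans_le ht.2))
    · exact (hGt.clm_apply (continuousOn_const (c := Pi.single α 1))).intervalIntegrable
  have hint : (∫ s in (0 : ℝ)..t, (fderivWithin ℝ u (slab T) (x, s)).comp
      (.inl ℝ (Fin 3 → ℝ) ℝ)) (Pi.single α 1) = f α (x, t) - f α (x, 0) := by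
    rw [ContinuousLinearMap.intervalIntegral_apply hGt.intervalIntegrable, ← hftc]
    rfl
  rw [add_apply, hint, ← h0, add_sub_cancel]

/-- A field that is a spatial gradient at each time is curl free. -/
theorem pdxW_comm_of_gradient {T t : ℝ} {f : Fin 3 → Pt → ℝ} {y : (Fin 3 → ℝ) → ℝ}
    (ht : t ∈ Set.Icc 0 T) (hf : ∀ α, DifferentiableOn ℝ (f α) (slab T))
    (hy : ∀ x, HasFDerivAt y
      (∑ α, f α (x, t) • ContinuousLinearMap.proj (R := ℝ) (φ := fun _ : Fin 3 => ℝ) α) x)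
    (x : Fin 3 → ℝ) (α β : Fin 3) :
    pdxW (slab T) α (f β) (x, t) = pdxW (slab T) β (f α) (x, t) := by
  have hd := HasFDerivAt.fun_sum (u := Finset.univ) fun α _ =>
    ((hf α (x, t) ht).hasFDerivWithinAt.slab_space ht).smul_const
      (ContinuousLinearMap.proj (R := ℝ) (φ := fun _ : Fin 3 => ℝ) α)
  have := second_derivative_symmetric hy hd (Pi.single α 1) (Pi.single β 1)
  simpa [pdxW, Pi.single_apply, sum_apply] using this

theorem HasFDerivWithinAt.cof_apply {S : Set Pt} {G : Pt → Mat} {A : Fin 3 → Fin 3 → Pt →L[ℝ] ℝ}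
    {p : Pt} (hG : ∀ i α, HasFDerivWithinAt (fun q => G q i α) (A i α) S p) (i α : Fin 3) :
    HasFDerivWithinAt (fun q => cof (G q) i α)
      (G p (i + 1) (α + 1) • A (i + 2) (α + 2) + G p (i + 2) (α + 2) • A (i + 1) (α + 1)
        - (G p (i + 1) (α + 2) • A (i + 2) (α + 1) + G p (i + 2) (α + 1) • A (i + 1) (α + 2)))
      S p := by
  simp only [_root_.cof_apply]
  exact ((hG _ _).fun_mul (hG _ _)).fun_sub ((hG _ _).fun_mul (hG _ _))

theorem HasFDerivWithinAt.mdet {S : Set Pt} {G : Pt → Mat} {A : Fin 3 → Fin 3 → Pt →L[ℝ] ℝ}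
    {p : Pt} (hG : ∀ i α, HasFDerivWithinAt (fun q => G q i α) (A i α) S p) :
    HasFDerivWithinAt (fun q => mdet (G q)) (∑ i, ∑ α, cof (G p) i α • A i α) S p := by
  simp only [mdet_eq_sum_cof]
  refine (HasFDerivWithinAt.fun_sum fun α _ =>
    (hG 0 α).fun_mul (HasFDerivWithinAt.cof_apply hG 0 α)).congr_fderiv ?_
  refine ContinuousLinearMap.ext fun z => ?_
  simp only [Fin.sum_univ_three, _root_.cof_apply, add_apply, sub_apply, smul_apply, smul_eq_mul]
  simp
  ring

theorem pdxW_piola_flux {S : Set Pt} (hS : UniqueDiffOn ℝ S) {p : Pt} (hp : p ∈ S)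
    {G : Pt → Mat} {u : Pt → Fin 3 → ℝ}
    (hG : ∀ i α, DifferentiableOn ℝ (fun q => G q i α) S)
    (hu : ∀ i, DifferentiableOn ℝ (fun q => u q i) S)
    (k γ α : Fin 3) :
    pdxW S α (fun q => ∑ i, ∑ j, ∑ β, lc i j k * lc α β γ * G q j β * u q i) p =
      ∑ i, ∑ j, ∑ β, (lc i j k * lc α β γ * G p j β * pdxW S α (fun q => u q i) p
        + u p i * (lc i j k * lc α β γ * pdxW S α (fun q => G q j β) p)) := by
  have := HasFDerivWithinAt.fun_sum (u := Finset.univ) fun i _ =>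
    HasFDerivWithinAt.fun_sum (u := Finset.univ) fun j _ =>
    HasFDerivWithinAt.fun_sum (u := Finset.univ) fun β _ =>
    (((hG j β p hp).hasFDerivWithinAt.const_mul (lc i j k * lc α β γ)).fun_mul
      (hu i p hp).hasFDerivWithinAt)
  rw [pdxW, this.fderivWithin (hS p hp)]
  simp [pdxW, sum_apply]

/-- Piola's identity: the rows of the cofactor matrix of a curl-free field are divergence free. -/
theorem sum_pdxW_cof {S : Set Pt} (hS : UniqueDiffOn ℝ S) {p : Pt} (hp : p ∈ S) {G : Pt → Mat}
    (hG : ∀ i α, DifferentiableOn ℝ (fun q => G q i α) S)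
    (hcurl : ∀ i α β, pdxW S α (fun q => G q i β) p = pdxW S β (fun q => G q i α) p) (i : Fin 3) :
    ∑ α, pdxW S α (fun q => cof (G q) i α) p = 0 := by
  have hcof := fun α => (HasFDerivWithinAt.cof_apply
    (fun i α => (hG i α p hp).hasFDerivWithinAt) i α).fderivWithin (hS p hp)
  simp only [pdxW] at hcurl ⊢
  have h10 := fun i => hcurl i 1 0
  have h20 := fun i => hcurl i 2 0
  have h21 := fun i => hcurl i 2 1
  simp [hcof, Fin.sum_univ_three, h10, h20, h21]
  ring

theorem pdxW_cof_mul {S : Set Pt} (hS : UniqueDiffOn ℝ S) {p : Pt} (hp : p ∈ S)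
    {G : Pt → Mat} {u : Pt → Fin 3 → ℝ}
    (hG : ∀ i α, DifferentiableOn ℝ (fun q => G q i α) S)
    (hu : ∀ i, DifferentiableOn ℝ (fun q => u q i) S) (i α : Fin 3) :
    pdxW S α (fun q => cof (G q) i α * u q i) p =
      cof (G p) i α * pdxW S α (fun q => u q i) p
        + u p i * pdxW S α (fun q => cof (G q) i α) p := by
  have hcof := (HasFDerivWithinAt.cof_apply
    (fun i α => (hG i α p hp).hasFDerivWithinAt) i α).differentiableWithinAt
  rw [pdxW, (hcof.hasFDerivWithinAt.fun_mul (hu i p hp).hasFDerivWithinAt).fderivWithin (hS p hp)]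
  rfl

/-- propagation of the constraint `ξ = Φ(F)` for smooth solutions of
the augmented system.  If `ξ = (F,ζ,w)` solves the kinematic transport equations on
`ℝ³ × [0,T]` with initial data `F(·,0) = ∇y⁰`, `ζ(·,0) = cof F(·,0)`,
`w(·,0) = det F(·,0)`, then for all `t ∈ [0,T]`: `F(·,t) = ∇ₓ y(·,t)` where
`y(x,t) = y⁰(x) + ∫₀ᵗ v(x,s) ds`, and `ζ(·,t) = cof F(·,t)`, `w(·,t) = det F(·,t)`. -/
theorem constraint_propagation (T : ℝ) (hT : 0 < T)
    (v : Pt → Fin 3 → ℝ) (y0 : (Fin 3 → ℝ) → Fin 3 → ℝ)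
    (F ζ' : Pt → Mat) (w : Pt → ℝ)
    (hv : ContDiffOn ℝ 2 v (slab T)) (hy0 : ContDiff ℝ 2 y0)
    (hF : ContDiffOn ℝ 1 F (slab T)) (hζ : ContDiffOn ℝ 1 ζ' (slab T))
    (hw : ContDiffOn ℝ 1 w (slab T))
    (heqF : ∀ p ∈ slab T, ∀ i β : Fin 3,
      pdtW (slab T) (fun q => F q i β) p = pdxW (slab T) β (fun q => v q i) p)
    (heqζ : ∀ p ∈ slab T, ∀ k γ : Fin 3,
      pdtW (slab T) (fun q => ζ' q k γ) p
        = ∑ α, pdxW (slab T) α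
            (fun q => ∑ i, ∑ j, ∑ β, lc i j k * lc α β γ * F q j β * v q i) p)
    (heqw : ∀ p ∈ slab T,
      pdtW (slab T) w p = ∑ i, ∑ α, pdxW (slab T) α (fun q => cof (F q) i α * v q i) p)
    (hF0 : ∀ x : Fin 3 → ℝ, ∀ i α : Fin 3,
      F (x, 0) i α = fderiv ℝ (fun z => y0 z i) x (Pi.single α 1))
    (hζ0 : ∀ x : Fin 3 → ℝ, ζ' (x, 0) = cof (F (x, 0)))
    (hw0 : ∀ x : Fin 3 → ℝ, w (x, 0) = mdet (F (x, 0))) :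
    ∀ p ∈ slab T,
      (∀ i α : Fin 3,
        F p i α = fderiv ℝ
          (fun x => y0 x i + ∫ s in (0:ℝ)..p.2, v (x, s) i) p.1 (Pi.single α 1))
      ∧ ζ' p = cof (F p) ∧ w p = mdet (F p) := by
  have hS := uniqueDiffOn_slab hT
  have hv1 : ∀ i, ContDiffOn ℝ 1 (fun q => v q i) (slab T) := fun i =>
    contDiffOn_pi.1 (hv.of_le one_le_two) i
  have hF1 : ∀ i α, ContDiffOn ℝ 1 (fun q => F q i α) (slab T) := fun i α =>
    contDiffOn_pi.1 (contDiffOn_pi.1 hF i) α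
  have hvd := fun i => (hv1 i).differentiableOn one_ne_zero
  have hFd := fun i α => (hF1 i α).differentiableOn one_ne_zero
  have hgrad : ∀ (x : Fin 3 → ℝ) (t : ℝ), t ∈ Set.Icc 0 T → ∀ i, HasFDerivAt
      (fun z => y0 z i + ∫ s in (0 : ℝ)..t, v (z, s) i)
      (∑ α, F (x, t) i α • ContinuousLinearMap.proj (R := ℝ) (φ := fun _ : Fin 3 => ℝ) α) x :=
    fun x t ht i => hasFDerivAt_add_integral_slab hT (hv1 i)
      ((contDiff_pi.1 hy0 i).differentiable two_ne_zero) (hF1 i)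
      (fun p hp α => heqF p hp i α) (fun x α => hF0 x i α) x ht
  have hcurl : ∀ p ∈ slab T, ∀ i α β,
      pdxW (slab T) α (fun q => F q i β) p = pdxW (slab T) β (fun q => F q i α) p :=
    fun p hp i α β =>
      pdxW_comm_of_gradient (f := fun α q => F q i α) hp (hFd i) (fun x => hgrad x p.2 hp i)
        p.1 α β
  have hdF := fun p hp i α => (hFd i α p hp).hasFDerivWithinAt
  have hcof := fun p hp => HasFDerivWithinAt.cof_apply (hdF p hp)
  have hdet := fun p hp => HasFDerivWithinAt.mdet (hdF p hp)
  have hζd : ∀ k γ, DifferentiableOn ℝ (fun q => ζ' q k γ) (slab T) := fun k γ =>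
    (contDiffOn_pi.1 (contDiffOn_pi.1 hζ k) γ).differentiableOn one_ne_zero
  have hwd := hw.differentiableOn one_ne_zero
  intro p hp
  refine ⟨fun i α => ?_, ?_, ?_⟩
  · rw [(hgrad p.1 p.2 hp i).fderiv]
    simp [sum_apply, Pi.single_apply]
  · ext k γ
    have h := eq_initial_of_pdtW_eq_zero hT (f := fun q => ζ' q k γ - cof (F q) k γ)
      (fun q hq => (hζd k γ q hq).sub (hcof q hq k γ).differentiableWithinAt)
      (fun q hq => ?_) hp
    · simpa [hζ0, sub_eq_zero] using h
    · have hζt := heqζ q hq k γ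
      simp only [pdxW_piola_flux hS hq hFd hvd] at hζt
      rw [sum_piola_flux _ _ _ (fun α i => pdxW (slab T) α (fun q => v q i) q)
        (hcurl q hq)] at hζt
      rw [pdtW, ((hζd k γ q hq).hasFDerivWithinAt.fun_sub (hcof q hq k γ)).fderivWithin (hS q hq)]
      simp only [sub_apply, add_apply, smul_apply, smul_eq_mul, ← pdtW.eq_def, hζt, heqF q hq]
      ring
  · have h := eq_initial_of_pdtW_eq_zero hT (f := fun q => w q - mdet (F q))
      (fun q hq => (hwd q hq).sub (hdet q hq).differentiableWithinAt)
      (fun q hq => ?_) hp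
    · simpa [hw0, sub_eq_zero] using h
    · have hwt := heqw q hq
      simp only [pdxW_cof_mul hS hq hFd hvd, Finset.sum_add_distrib, ← Finset.mul_sum,
        sum_pdxW_cof hS hq hFd (hcurl q hq), mul_zero, add_zero] at hwt
      rw [pdtW, ((hwd q hq).hasFDerivWithinAt.fun_sub (hdet q hq)).fderivWithin (hS q hq)]
      simp only [sub_apply, sum_apply, smul_apply, smul_eq_mul, ← pdtW.eq_def, hwt, heqF q hq,
        sub_self]
end
end

section
/- (L² distance between piecewise linear and piecewise constant interpolants.) Let H be a real normed vector space, let N ∈ ℕ, h > 0, E ≥ 0, and let U⁰, U¹, …, U^N ∈ H satisfy Σ_{j=1}^N ‖U^j − U^{j−1}‖² ≤ E. Define the piecewise linear interpolant V(t) = U^{j−1} + ((t − (j−1)h)/h)(U^j − U^{j−1}) and the piecewise constant interpolant u(t) = U^j for t ∈ ((j−1)h, jh], j = 1,…,N. Then ( ∫₀^{Nh} ‖V(t) − u(t)‖² dt )^{1/2} ≤ √(hE/3) ≤ √(hE). -/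
open scoped BigOperators
noncomputable section

open MeasureTheory in
/-- On one step, the squared distance to the right endpoint value is an explicit quadratic. -/
theorem integral_sq_norm_linear_sub_right {H : Type*} [NormedAddCommGroup H] [NormedSpace ℝ H]
    {a b h : ℝ} (hh : 0 < h) (hab : b = a + h) (x y : H) (V u : ℝ → H)
    (hV : ∀ t ∈ Set.Ioc a b, V t = x + ((t - a) / h) • (y - x))
    (hu : ∀ t ∈ Set.Ioc a b, u t = y) :
    IntervalIntegrable (fun t => ‖V t - u t‖ ^ 2) volume a b ∧
      ∫ t in a..b, ‖V t - u t‖ ^ 2 = h / 3 * ‖y - x‖ ^ 2 := by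
  have hle : a ≤ b := by linarith
  have key : Set.EqOn (fun t => ‖y - x‖ ^ 2 / h ^ 2 * (b - t) ^ 2)
      (fun t => ‖V t - u t‖ ^ 2) (Set.uIoc a b) := by
    intro t ht
    rw [Set.uIoc_of_le hle] at ht
    have hvec : V t - u t = ((t - b) / h) • (y - x) := by
      have hc : (t - b) / h = (t - a) / h - 1 := by
        rw [hab]; field_simp; ring
      rw [hV t ht, hu t ht, hc, sub_smul, one_smul]
      abel
    simp only [hvec, norm_smul, mul_pow, Real.norm_eq_abs, sq_abs]
    ring
  refine ⟨IntervalIntegrable.congr key (Continuous.intervalIntegrable (by fun_prop) _ _), ?_⟩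
  rw [← intervalIntegral.integral_congr_ae (ae_of_all _ key), intervalIntegral.integral_const_mul,
    intervalIntegral.integral_comp_sub_left (fun t => t ^ 2) b, integral_pow, hab]
  field_simp
  ring

/-- L² distance between the piecewise linear and piecewise constant
interpolants.  Let `H` be a real normed vector space, `U⁰,…,U^N ∈ H` with
`Σ_{j=1}^N ‖U^j − U^{j−1}‖² ≤ E`, and let `V` (piecewise linear) and `u` (piecewise
constant) be the interpolants with time step `h > 0`.  Then
`(∫₀^{Nh} ‖V(t) − u(t)‖² dt)^{1/2} ≤ √(hE/3) ≤ √(hE)`. -/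
theorem interpolant_L2_distance
    {H : Type*} [NormedAddCommGroup H] [NormedSpace ℝ H]
    (N : ℕ) (h E : ℝ) (hh : 0 < h) (hE : 0 ≤ E)
    (U : ℕ → H)
    (hsum : ∑ j ∈ Finset.Icc 1 N, ‖U j - U (j-1)‖^2 ≤ E)
    (V u : ℝ → H)
    (hV : ∀ j ∈ Finset.Icc 1 N, ∀ t ∈ Set.Ioc (((j:ℝ)-1)*h) ((j:ℝ)*h),
      V t = U (j-1) + ((t - ((j:ℝ)-1)*h)/h) • (U j - U (j-1)))
    (hu : ∀ j ∈ Finset.Icc 1 N, ∀ t ∈ Set.Ioc (((j:ℝ)-1)*h) ((j:ℝ)*h), u t = U j) :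
    Real.sqrt (∫ t in (0:ℝ)..((N:ℝ)*h), ‖V t - u t‖^2) ≤ Real.sqrt (h*E/3)
      ∧ Real.sqrt (h*E/3) ≤ Real.sqrt (h*E) := by
  have step (k : ℕ) (hk : k < N) :=
    integral_sq_norm_linear_sub_right (a := (k : ℝ) * h) (b := ((k + 1 : ℕ) : ℝ) * h) hh
      (by push_cast; ring) (U k) (U (k + 1)) V u
      (by simpa using hV (k + 1) (Finset.mem_Icc.2 ⟨by omega, by omega⟩))
      (by simpa using hu (k + 1) (Finset.mem_Icc.2 ⟨by omega, by omega⟩))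
  have hint : ∫ t in (0 : ℝ)..((N : ℝ) * h), ‖V t - u t‖ ^ 2
      = h / 3 * ∑ j ∈ Finset.Icc 1 N, ‖U j - U (j - 1)‖ ^ 2 := by
    have hadj := intervalIntegral.sum_integral_adjacent_intervals
      (a := fun k : ℕ => (k : ℝ) * h) (fun k hk => (step k hk).1)
    simp only [Nat.cast_zero, zero_mul] at hadj
    rw [← hadj, Finset.sum_congr rfl fun k hk => (step k (Finset.mem_range.1 hk)).2,
      ← Finset.mul_sum, ← Finset.Ico_add_one_right_eq_Icc, Finset.sum_Ico_eq_sum_range]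
    simp [add_comm]
  have hhE : 0 ≤ h * E := mul_nonneg hh.le hE
  refine ⟨Real.sqrt_le_sqrt ?_, Real.sqrt_le_sqrt (by linarith)⟩
  calc _ = _ := hint
    _ ≤ h / 3 * E := by gcongr
    _ = h * E / 3 := by ring
end
end
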